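/- The Knothe–Rosenblatt rearrangement is bicausal: For any Borel probability measures μ, ν on ℝ^N, the Knothe–Rosenblatt rearrangement of (μ,ν) belongs to Π_bc(μ,ν). In particular (in the case N ≥ 2, t = 1), with X*₁ = F_{μ₁}^{−1}(U₁), Y*₁ = F_{ν₁}^{−1}(U₁), Y*₂ = F_{ν^{Y*₁}}^{−1}(U₂) for U₁, U₂ independent uniforms on [0,1], the conditional law of X*₁ given (Y*₁, Y*₂) equals the conditional law of X*₁ given Y*₁. -/

import Mathlib

open MeasureTheory ProbabilityTheory Set Filter
open scoped ENNReal NNReal BoundedContinuousFunction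

noncomputable section

namespace CausalTransport

/-- The path space of a real-valued process in `N` time steps. -/
abbrev Path (N : ℕ) := Fin N → ℝ

/-- Truncation of a path to its first `t` coordinates. -/
def proj (N t : ℕ) (x : Path N) : Fin t → ℝ :=
  fun i => if h : (i : ℕ) < N then x ⟨i, h⟩ else 0

/-- The coordinate with (0-based) index `t`, with junk value `0` if `t ≥ N`. -/
def coord (N t : ℕ) (x : Path N) : ℝ := if h : t < N then x ⟨t, h⟩ else 0

/-- The coordinates of a path after time `t`. -/
def tailProj (N t : ℕ) (x : Path N) : Fin (N - t) → ℝ := fun i => coord N (t + i) x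

/-- Extension of a history of length `t` by one further value. -/
def snocFun (t : ℕ) (xs : Fin t → ℝ) (r : ℝ) : Fin (t + 1) → ℝ :=
  fun i => if h : (i : ℕ) < t then xs ⟨i, h⟩ else r

/-- Extension of a history of length `t` to a full path (by `0`). -/
def pad (N t : ℕ) (xs : Fin t → ℝ) : Path N :=
  fun i => if h : (i : ℕ) < t then xs ⟨i, h⟩ else 0

/-- Glue the first `t` coordinates of `x` with the later coordinates `z`. -/
def glue (N t : ℕ) (x : Path N) (z : Fin (N - t) → ℝ) : Path N :=
  fun i => if (i : ℕ) < t then x i else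
    if h : (i : ℕ) - t < N - t then z ⟨(i : ℕ) - t, h⟩ else 0

/-- Truncation of a pair of paths to the first `t` coordinates of each. -/
def pairProj (N t : ℕ) (p : Path N × Path N) : (Fin t → ℝ) × (Fin t → ℝ) :=
  (proj N t p.1, proj N t p.2)

/-- The σ-algebra on path space generated by the first `t` coordinates. -/
def filt (N t : ℕ) : MeasurableSpace (Path N) :=
  MeasurableSpace.comap (proj N t) inferInstance

/-- `γ` is a transport plan (coupling) between `μ` and `ν`. -/
def IsCoupling {α β : Type*} [MeasurableSpace α] [MeasurableSpace β]
    (μ : Measure α) (ν : Measure β) (γ : Measure (α × β)) : Prop :=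
  γ.map Prod.fst = μ ∧ γ.map Prod.snd = ν

/-- `γ` is a causal transport plan between `μ` and `ν`: it is a coupling and, for any
disintegration `K` of `γ` over its first coordinate and any `t ∈ {1,…,N}`, the map
`x ↦ K x B` is measurable for the σ-algebra of the first `t` coordinates (up to `μ`-null
sets) whenever `B` is measurable for the first `t` coordinates. -/
def IsCausal (N : ℕ) (μ ν : Measure (Path N)) (γ : Measure (Path N × Path N)) : Prop :=
  IsCoupling μ ν γ ∧
  ∀ K : Kernel (Path N) (Path N), IsSFiniteKernel K → μ ⊗ₘ K = γ →
    ∀ t : ℕ, 1 ≤ t → t ≤ N → ∀ B : Set (Path N), MeasurableSet[filt N t] B →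
      ∃ g : Path N → ℝ≥0∞, Measurable[filt N t] g ∧ (fun x => K x B) =ᵐ[μ] g

/-- `γ` is a bicausal transport plan between `μ` and `ν`. -/
def IsBicausal (N : ℕ) (μ ν : Measure (Path N)) (γ : Measure (Path N × Path N)) : Prop :=
  IsCausal N μ ν γ ∧ IsCausal N ν μ (γ.map Prod.swap)

/-- Regular conditional distribution, under `μ`, of the coordinate of index `t`
given the first `t` coordinates. -/
def nextK (N : ℕ) (μ : Measure (Path N)) [IsFiniteMeasure μ] (t : ℕ) :
    Kernel (Fin t → ℝ) ℝ :=
  (μ.map (fun x => (proj N t x, coord N t x))).condKernel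

/-- Regular conditional distribution, under `μ`, of all the coordinates after time `t`
given the first `t` coordinates. -/
def tailK (N : ℕ) (μ : Measure (Path N)) [IsFiniteMeasure μ] (t : ℕ) :
    Kernel (Fin t → ℝ) (Fin (N - t) → ℝ) :=
  (μ.map (fun x => (proj N t x, tailProj N t x))).condKernel

/-- Regular conditional distribution, under `γ`, of the pair of coordinates of index `t`
given the first `t` coordinates of both paths. -/
def stepK (N : ℕ) (γ : Measure (Path N × Path N)) [IsFiniteMeasure γ] (t : ℕ) :
    Kernel ((Fin t → ℝ) × (Fin t → ℝ)) (ℝ × ℝ) :=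
  (γ.map (fun p => (pairProj N t p, (coord N t p.1, coord N t p.2)))).condKernel

/-- Regular conditional distribution, under `μ`, of the coordinate of index `t` given the
single coordinate of index `t-1` (one-step Markov transition kernel). -/
def mstep (N : ℕ) (μ : Measure (Path N)) [IsFiniteMeasure μ] (t : ℕ) : Kernel ℝ ℝ :=
  (μ.map (fun x => (coord N (t - 1) x, coord N t x))).condKernel

/-- `μ` is a Markov measure. -/
def IsMarkovMeasure (N : ℕ) (μ : Measure (Path N)) [IsFiniteMeasure μ] : Prop :=
  ∀ (t : ℕ) (ht : 1 ≤ t) (_ : t < N),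
    ∀ᵐ xs ∂(μ.map (proj N t)), nextK N μ t xs = mstep N μ t (xs ⟨t - 1, by omega⟩)

/-- A causal plan is causal quasi-Markov if (every version of) the conditional law of
`(x_{t+1}, y_{t+1})` given `(x_1,…,x_t,y_1,…,y_t)` depends a.s. only on `(x_t, y_1,…,y_t)`. -/
def IsQuasiMarkov (N : ℕ) (γ : Measure (Path N × Path N)) : Prop :=
  ∀ (t : ℕ) (ht : 1 ≤ t) (_ : t < N),
    ∀ S : Kernel ((Fin t → ℝ) × (Fin t → ℝ)) (ℝ × ℝ), IsSFiniteKernel S →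
      (γ.map (pairProj N t)) ⊗ₘ S
          = γ.map (fun p => (pairProj N t p, (coord N t p.1, coord N t p.2))) →
      ∃ κ : Kernel (ℝ × (Fin t → ℝ)) (ℝ × ℝ),
        ∀ᵐ z ∂(γ.map (pairProj N t)), S z = κ (z.1 ⟨t - 1, by omega⟩, z.2)

/-- Topological support of a measure. -/
def msupport {α : Type*} [TopologicalSpace α] [MeasurableSpace α] (μ : Measure α) : Set α :=
  {x | ∀ U : Set α, IsOpen U → x ∈ U → μ U ≠ 0}

/-- `K` is a version of the disintegration of `μ` at time `t` which is weakly continuous on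
the support of the first `t` coordinates of `μ`. -/
def WeaklyContinuousDisintegration (N t : ℕ) (μ : Measure (Path N))
    (K : Kernel (Fin t → ℝ) (Fin (N - t) → ℝ)) : Prop :=
  IsMarkovKernel K ∧
  (μ.map (proj N t)) ⊗ₘ K = μ.map (fun x => (proj N t x, tailProj N t x)) ∧
  ∀ f : (Fin (N - t) → ℝ) →ᵇ ℝ,
    ContinuousOn (fun xs => ∫ z, f z ∂(K xs)) (msupport (μ.map (proj N t)))

/-- `μ` is successively weakly continuous. -/
def SuccWeakCont (N : ℕ) (μ : Measure (Path N)) : Prop :=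
  ∀ t : ℕ, t < N → ∃ K : Kernel (Fin t → ℝ) (Fin (N - t) → ℝ),
    WeaklyContinuousDisintegration N t μ K

/-- The cumulative distribution function of a measure on `ℝ`. -/
def cdf1 (η : Measure ℝ) (z : ℝ) : ℝ := (η (Iic z)).toReal

/-- The left-continuous generalized inverse (quantile function) of the c.d.f. of `η`. -/
def qinv (η : Measure ℝ) (u : ℝ) : ℝ := sInf {y : ℝ | u ≤ cdf1 η y}

/-- Partial Knothe–Rosenblatt path built from the "uniform" inputs `u`. -/
def krPartial (N : ℕ) (μ : Measure (Path N)) [IsFiniteMeasure μ] (u : ℕ → ℝ) :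
    (t : ℕ) → Fin t → ℝ
  | 0 => Fin.elim0
  | t + 1 => snocFun t (krPartial N μ u t)
      (qinv (nextK N μ t (krPartial N μ u t)) (u t))

/-- The Knothe–Rosenblatt (quantile transform) path built from uniform inputs. -/
def krPath (N : ℕ) (μ : Measure (Path N)) [IsFiniteMeasure μ] (u : Path N) : Path N :=
  krPartial N μ (fun n => if h : n < N then u ⟨n, h⟩ else 0) N

/-- The uniform distribution on `[0,1]`. -/
def unif01 : Measure ℝ := volume.restrict (Icc (0 : ℝ) 1)

instance : IsProbabilityMeasure unif01 := by
  constructor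
  simp [unif01, Real.volume_Icc]

/-- N independent uniforms on `[0,1]`. -/
def uniformCube (N : ℕ) : Measure (Path N) := Measure.pi fun _ => unif01

instance (N : ℕ) : IsProbabilityMeasure (uniformCube N) :=
  inferInstanceAs (IsProbabilityMeasure (Measure.pi fun _ : Fin N => unif01))

/-- The (increasing) Knothe–Rosenblatt rearrangement of `(μ, ν)`: the joint law of
`(X*, Y*)` where both paths are built from the same independent uniforms. -/
def krCoupling (N : ℕ) (μ ν : Measure (Path N)) [IsFiniteMeasure μ] [IsFiniteMeasure ν] :
    Measure (Path N × Path N) :=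
  (uniformCube N).map (fun u => (krPath N μ u, krPath N ν u))

/-- Partial Knothe–Rosenblatt Monge map. -/
def krMapPartial (N : ℕ) (μ ν : Measure (Path N)) [IsFiniteMeasure μ] [IsFiniteMeasure ν]
    (x : Path N) : (t : ℕ) → Fin t → ℝ
  | 0 => Fin.elim0
  | t + 1 => snocFun t (krMapPartial N μ ν x t)
      (qinv (nextK N ν t (krMapPartial N μ ν x t))
        (cdf1 (nextK N μ t (proj N t x)) (coord N t x)))

/-- The Knothe–Rosenblatt Monge map from `μ` to `ν`. -/
def krMap (N : ℕ) (μ ν : Measure (Path N)) [IsFiniteMeasure μ] [IsFiniteMeasure ν]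
    (x : Path N) : Path N :=
  krMapPartial N μ ν x N

open Classical in
/-- Relative entropy `Ent(ν|μ)`, via the nonnegative integrand `f log f - f + 1`,
`f = dν/dμ`; equals `∫ log (dν/dμ) dν` for probability measures. -/
def relEnt {α : Type*} [MeasurableSpace α] (ν μ : Measure α) : ℝ≥0∞ :=
  if ν ≪ μ then
    ∫⁻ x, ENNReal.ofReal
      ((ν.rnDeriv μ x).toReal * Real.log (ν.rnDeriv μ x).toReal
        - (ν.rnDeriv μ x).toReal + 1) ∂μ
  else ∞

/-- Universally measurable `ℝ≥0∞`-valued function. -/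
def UnivMeasurable {α : Type*} [MeasurableSpace α] (f : α → ℝ≥0∞) : Prop :=
  ∀ P : Measure α, IsFiniteMeasure P → AEMeasurable f P

/-! ### Helper lemmas -/

lemma compProd_cond {α β ω θ : Type*} [MeasurableSpace α] [MeasurableSpace β]
    [StandardBorelSpace β] [Nonempty β] [MeasurableSpace ω] [MeasurableSpace θ]
    (l : Measure (α × β)) [IsProbabilityMeasure l] (U : Measure ω) [IsProbabilityMeasure U]
    (Φ : α × ω → θ) (hΦ : Measurable Φ) (π : θ → α) (hπ : Measurable π)
    (h : ∀ a w, π (Φ (a, w)) = a) :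
    (l.prod U).map (fun p => (Φ (p.1.1, p.2), p.1.2))
      = ((l.prod U).map (fun p => Φ (p.1.1, p.2))) ⊗ₘ (l.condKernel.comap π hπ) := by
  have hm1 : Measurable (fun p : (α × β) × ω => Φ (p.1.1, p.2)) := by fun_prop
  have hm2 : Measurable (fun p : (α × β) × ω => (Φ (p.1.1, p.2), p.1.2)) := by fun_prop
  have : IsProbabilityMeasure ((l.prod U).map (fun p => Φ (p.1.1, p.2))) :=
    Measure.isProbabilityMeasure_map hm1.aemeasurable
  ext s hs
  have hmk : Measurable (fun z : θ => l.condKernel (π z) (Prod.mk z ⁻¹' s)) :=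
    Kernel.measurable_kernel_prodMk_left (κ := l.condKernel.comap π hπ) hs
  rw [Measure.map_apply hm2 hs, Measure.prod_apply_symm (hm2 hs), Measure.compProd_apply hs]
  simp only [Kernel.comap_apply]
  rw [lintegral_map hmk hm1, lintegral_prod_symm'
    (fun a : (α × β) × ω => l.condKernel (π (Φ (a.1.1, a.2))) (Prod.mk (Φ (a.1.1, a.2)) ⁻¹' s))
    (hmk.comp hm1)]
  refine lintegral_congr fun w => ?_
  have hS : MeasurableSet ((fun x : α × β => (x, w)) ⁻¹'
      ((fun p : (α × β) × ω => (Φ (p.1.1, p.2), p.1.2)) ⁻¹' s)) :=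
    measurable_prodMk_right (hm2 hs)
  have hd := l.disintegrate l.condKernel
  conv_lhs => rw [← hd]
  rw [Measure.compProd_apply hS, Measure.fst, lintegral_map ?_ measurable_fst]
  · refine lintegral_congr fun ab => ?_
    simp only [h]
    rfl
  · exact Kernel.measurable_kernel_prodMk_left hS

lemma qinv_le_iff (η : Measure ℝ) [IsProbabilityMeasure η] {u : ℝ} (hu : 0 < u)
    (hne : ∃ y, u ≤ cdf1 η y) (z : ℝ) : qinv η u ≤ z ↔ u ≤ cdf1 η z := by
  have hcdf : ∀ y, cdf1 η y = cdf η y := fun y => by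
    rw [cdf_eq_real]; rfl
  simp only [qinv, hcdf] at *
  have hbdd : BddBelow {y : ℝ | u ≤ cdf η y} := by
    have := (tendsto_cdf_atBot η).eventually (gt_mem_nhds hu)
    obtain ⟨b, hb⟩ := this.exists
    refine ⟨b, fun y hy => ?_⟩
    by_contra hlt
    have := monotone_cdf η (not_le.1 hlt).le
    have hy' : u ≤ cdf η y := hy
    linarith
  constructor
  · intro hle
    have hr := (cdf η).right_continuous z
    have h1 : ∀ w, z < w → u ≤ cdf η w := by
      intro w hw
      obtain ⟨y, hy, hyw⟩ := exists_lt_of_csInf_lt hne (lt_of_le_of_lt hle hw)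
      exact le_trans hy (monotone_cdf η hyw.le)
    have hr' : Tendsto (cdf η) (nhdsWithin z (Ioi z)) (nhds (cdf η z)) :=
      hr.tendsto.mono_left (nhdsWithin_mono _ Ioi_subset_Ici_self)
    exact ge_of_tendsto hr' (by filter_upwards [self_mem_nhdsWithin] with w hw using h1 w hw)
  · intro hz
    exact csInf_le hbdd hz

lemma qinv_of_nonpos (η : Measure ℝ) {u : ℝ} (hu : u ≤ 0) : qinv η u = 0 := by
  have : {y : ℝ | u ≤ cdf1 η y} = univ := by
    ext y; simp only [mem_ofPred_eq, mem_univ, iff_true]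
    exact hu.trans ENNReal.toReal_nonneg
  rw [qinv, this, Real.sInf_univ]

lemma qinv_of_empty (η : Measure ℝ) {u : ℝ} (hu : ¬ ∃ y, u ≤ cdf1 η y) : qinv η u = 0 := by
  have : {y : ℝ | u ≤ cdf1 η y} = ∅ := by
    ext y; simp only [mem_ofPred_eq, mem_empty_iff_false, iff_false]
    exact fun h => hu ⟨y, h⟩
  rw [qinv, this, Real.sInf_empty]

lemma cdf1_mono (η : Measure ℝ) [IsProbabilityMeasure η] : Monotone (cdf1 η) := fun a b hab =>
  ENNReal.toReal_mono (measure_ne_top _ _) (measure_mono (Iic_subset_Iic.2 hab))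

lemma measurable_qinv {α : Type*} [MeasurableSpace α] (κ : Kernel α ℝ) [IsMarkovKernel κ] :
    Measurable (fun p : α × ℝ => qinv (κ p.1) p.2) := by
  have hc : ∀ z, Measurable (fun p : α × ℝ => cdf1 (κ p.1) z) := fun z =>
    ((κ.measurable_coe measurableSet_Iic).comp measurable_fst).ennreal_toReal
  have hG : MeasurableSet {p : α × ℝ | 0 < p.2 ∧ ∃ n : ℕ, p.2 ≤ cdf1 (κ p.1) n} := by
    have he : {p : α × ℝ | 0 < p.2 ∧ ∃ n : ℕ, p.2 ≤ cdf1 (κ p.1) n}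
        = {p : α × ℝ | 0 < p.2} ∩ ⋃ n : ℕ, {p : α × ℝ | p.2 ≤ cdf1 (κ p.1) n} := by
      ext p; simp
    rw [he]
    exact (measurableSet_lt measurable_const measurable_snd).inter
      (MeasurableSet.iUnion fun n => measurableSet_le measurable_snd (hc n))
  have hnat : ∀ p : α × ℝ, (∃ n : ℕ, p.2 ≤ cdf1 (κ p.1) n) ↔ ∃ y, p.2 ≤ cdf1 (κ p.1) y := by
    intro p
    constructor
    · rintro ⟨n, hn⟩; exact ⟨n, hn⟩
    · rintro ⟨y, hy⟩
      obtain ⟨n, hn⟩ := exists_nat_ge y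
      exact ⟨n, hy.trans (cdf1_mono _ hn)⟩
  refine measurable_of_Iic fun z => ?_
  have : (fun p : α × ℝ => qinv (κ p.1) p.2) ⁻¹' Iic z =
      ({p : α × ℝ | 0 < p.2 ∧ ∃ n : ℕ, p.2 ≤ cdf1 (κ p.1) n} ∩ {p | p.2 ≤ cdf1 (κ p.1) z})
      ∪ ({p : α × ℝ | 0 < p.2 ∧ ∃ n : ℕ, p.2 ≤ cdf1 (κ p.1) n}ᶜ ∩ {p | 0 ≤ z}) := by
    ext p
    simp only [mem_preimage, mem_Iic, mem_union, mem_inter_iff, mem_ofPred_eq, mem_compl_iff, hnat]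
    by_cases h1 : 0 < p.2
    · by_cases h2 : ∃ y, p.2 ≤ cdf1 (κ p.1) y
      · rw [qinv_le_iff _ h1 h2]; simp [h1, h2]
      · rw [qinv_of_empty _ h2]; simp [h1, h2]
    · rw [qinv_of_nonpos _ (not_lt.1 h1)]; simp [h1]
  rw [this]
  exact (hG.inter (measurableSet_le measurable_snd (hc z))).union
    (hG.compl.inter (MeasurableSet.const _))

lemma measurable_qinv_right (η : Measure ℝ) [IsProbabilityMeasure η] : Measurable (qinv η) :=
  (measurable_qinv (Kernel.const Unit η)).comp (measurable_prodMk_left (x := ()))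

lemma map_qinv (η : Measure ℝ) [IsProbabilityMeasure η] : unif01.map (qinv η) = η := by
  have : IsProbabilityMeasure (unif01.map (qinv η)) :=
    Measure.isProbabilityMeasure_map (measurable_qinv_right η).aemeasurable
  refine Measure.ext_of_Iic _ _ fun z => ?_
  rw [Measure.map_apply (measurable_qinv_right η) measurableSet_Iic]
  have hz0 : 0 ≤ cdf1 η z := ENNReal.toReal_nonneg
  have hz1 : cdf1 η z ≤ 1 := by
    have := (ENNReal.toReal_le_toReal (measure_ne_top η (Iic z)) ENNReal.one_ne_top).2 prob_le_one
    simpa [cdf1] using this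
  have hae : ∀ᵐ u ∂unif01, 0 < u ∧ u < 1 := by
    rw [unif01, ← Measure.restrict_congr_set Ioo_ae_eq_Icc]
    exact ae_restrict_mem measurableSet_Ioo
  have : (qinv η ⁻¹' Iic z : Set ℝ) =ᵐ[unif01] (Iic (cdf1 η z) : Set ℝ) := by
    filter_upwards [hae] with u hu
    have hne : ∃ y, u ≤ cdf1 η y := by
      have hcdf : ∀ y, cdf1 η y = cdf η y := fun y => by
        rw [cdf_eq_real]; rfl
      have := (tendsto_cdf_atTop η).eventually (lt_mem_nhds hu.2)
      obtain ⟨b, hb⟩ := this.exists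
      exact ⟨b, by rw [hcdf]; exact hb.le⟩
    exact propext (qinv_le_iff η hu.1 hne z)
  rw [measure_congr this, unif01, Measure.restrict_apply measurableSet_Iic]
  have : Iic (cdf1 η z) ∩ Icc 0 1 = Icc 0 (cdf1 η z) := by
    ext x; simp only [mem_inter_iff, mem_Iic, mem_Icc]
    constructor
    · rintro ⟨a, b, c⟩; exact ⟨b, a⟩
    · rintro ⟨a, b⟩; exact ⟨b, a, b.trans hz1⟩
  rw [this, Real.volume_Icc, sub_zero, cdf1, ENNReal.ofReal_toReal (measure_ne_top _ _)]

lemma prod_unif_map_qinv {α : Type*} [MeasurableSpace α] (ρ : Measure α) [IsProbabilityMeasure ρ]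
    (κ : Kernel α ℝ) [IsMarkovKernel κ] :
    (ρ.prod unif01).map (fun p => (p.1, qinv (κ p.1) p.2)) = ρ ⊗ₘ κ := by
  have hm : Measurable (fun p : α × ℝ => (p.1, qinv (κ p.1) p.2)) :=
    measurable_fst.prodMk (measurable_qinv κ)
  ext s hs
  rw [Measure.map_apply hm hs, Measure.prod_apply (hm hs), Measure.compProd_apply hs]
  refine lintegral_congr fun a => ?_
  conv_rhs => rw [← map_qinv (κ a)]
  rw [Measure.map_apply (measurable_qinv_right _) (measurable_prodMk_left hs)]
  rfl

/-- Replace the coordinates from `t` on by those of a second vector. -/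
def mix (N t : ℕ) (p : Path N × Path N) : Path N := fun i => if (i : ℕ) < t then p.1 i else p.2 i

lemma measurable_mix (N t : ℕ) : Measurable (mix N t) := by
  refine measurable_pi_lambda _ fun i => ?_
  unfold mix
  split_ifs <;> fun_prop

lemma map_mix (N t : ℕ) : ((uniformCube N).prod (uniformCube N)).map (mix N t) = uniformCube N := by
  refine (Measure.pi_eq fun s hs => ?_).symm
  rw [Measure.map_apply (measurable_mix N t) (MeasurableSet.univ_pi hs)]
  have : mix N t ⁻¹' (univ.pi s) =
      (univ.pi fun i : Fin N => if (i : ℕ) < t then s i else univ) ×ˢ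
      (univ.pi fun i : Fin N => if (i : ℕ) < t then univ else s i) := by
    ext p
    simp only [mem_preimage, Set.mem_pi, mem_univ, true_imp_iff, mem_prod, mix, ← forall_and]
    refine forall_congr' fun i => ?_
    split_ifs <;> simp
  rw [this, Measure.prod_prod, uniformCube, Measure.pi_pi, Measure.pi_pi, ← Finset.prod_mul_distrib]
  refine Finset.prod_congr rfl fun i _ => ?_
  split_ifs <;> simp

/-- Continue a history `x` of length `t` by the quantile recursion. -/
def ext (N : ℕ) (μ : Measure (Path N)) [IsFiniteMeasure μ] (t : ℕ) (p : (Fin t → ℝ) × Path N) :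
    (s : ℕ) → Fin s → ℝ
  | 0 => Fin.elim0
  | s + 1 => snocFun s (ext N μ t p s)
      (if h : s < t then p.1 ⟨s, h⟩ else
        qinv (nextK N μ s (ext N μ t p s)) (coord N s p.2))

lemma measurable_snocFun (t : ℕ) : Measurable (fun p : (Fin t → ℝ) × ℝ => snocFun t p.1 p.2) := by
  refine measurable_pi_lambda _ fun i => ?_
  unfold snocFun
  split_ifs <;> fun_prop

lemma measurable_coord (N t : ℕ) : Measurable (coord N t) := by
  unfold coord
  split_ifs <;> fun_prop

lemma measurable_proj (N t : ℕ) : Measurable (proj N t) := by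
  refine measurable_pi_lambda _ fun i => ?_
  unfold proj
  split_ifs <;> fun_prop

instance (N : ℕ) (μ : Measure (Path N)) [IsFiniteMeasure μ] (t : ℕ) :
    IsMarkovKernel (nextK N μ t) := by unfold nextK; infer_instance

lemma measurable_ext (N : ℕ) (μ : Measure (Path N)) [IsFiniteMeasure μ] (t s : ℕ) :
    Measurable (fun p => ext N μ t p s) := by
  induction s with
  | zero => exact measurable_pi_lambda _ fun i => i.elim0
  | succ s ih =>
    have hd : Measurable (fun p : (Fin t → ℝ) × Path N => (if h : s < t then p.1 ⟨s, h⟩ else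
        qinv (nextK N μ s (ext N μ t p s)) (coord N s p.2))) := by
      by_cases h : s < t
      · simp only [h, dif_pos]
        fun_prop
      · simp only [h, dif_neg, not_false_eq_true]
        exact (measurable_qinv (nextK N μ s)).comp
          (ih.prodMk ((measurable_coord N s).comp measurable_snd))
    exact (measurable_snocFun s).comp (ih.prodMk hd)

/-- `krPartial` as a function of a vector of inputs. -/
abbrev krP (N : ℕ) (μ : Measure (Path N)) [IsFiniteMeasure μ] (u : Path N) (t : ℕ) : Fin t → ℝ :=
  krPartial N μ (fun n => if h : n < N then u ⟨n, h⟩ else 0) t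

lemma krP_succ (N : ℕ) (μ : Measure (Path N)) [IsFiniteMeasure μ] (u : Path N) (t : ℕ) :
    krP N μ u (t + 1) = snocFun t (krP N μ u t) (qinv (nextK N μ t (krP N μ u t)) (coord N t u)) :=
  rfl

lemma krP_eq_ext (N : ℕ) (μ : Measure (Path N)) [IsFiniteMeasure μ] (u : Path N) (t : ℕ) :
    krP N μ u t = ext N μ 0 (Fin.elim0, u) t := by
  induction t with
  | zero => exact funext fun i => i.elim0
  | succ t ih => rw [krP_succ, ih]; simp [ext]

lemma measurable_krP (N : ℕ) (μ : Measure (Path N)) [IsFiniteMeasure μ] (t : ℕ) :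
    Measurable (fun u => krP N μ u t) := by
  simp only [krP_eq_ext]
  exact (measurable_ext N μ 0 t).comp measurable_prodMk_left

lemma krP_apply (N : ℕ) (μ : Measure (Path N)) [IsFiniteMeasure μ] (u : Path N) (s t : ℕ)
    (hst : s ≤ t) (i : ℕ) (hi : i < s) : krP N μ u t ⟨i, hi.trans_le hst⟩ = krP N μ u s ⟨i, hi⟩ := by
  induction t, hst using Nat.le_induction with
  | base => rfl
  | succ t hst ih =>
    rw [krP_succ, snocFun]
    simp only [hi.trans_le hst, dif_pos]
    exact ih

lemma ext_apply (N : ℕ) (μ : Measure (Path N)) [IsFiniteMeasure μ] (t : ℕ)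
    (p : (Fin t → ℝ) × Path N) (s i : ℕ) (hi : i < s) (hit : i < t) :
    ext N μ t p s ⟨i, hi⟩ = p.1 ⟨i, hit⟩ := by
  induction s with
  | zero => omega
  | succ s ih =>
    simp only [ext, snocFun]
    split_ifs with h1 h2
    · exact ih h1
    · have : i = s := by omega
      subst this; rfl
    · omega

lemma krP_mix_le (N : ℕ) (μ : Measure (Path N)) [IsFiniteMeasure μ] (t : ℕ) (p : Path N × Path N)
    (s : ℕ) (hs : s ≤ t) : krP N μ (mix N t p) s = krP N μ p.1 s := by
  induction s with
  | zero => exact funext fun i => i.elim0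
  | succ s ih =>
    rw [krP_succ, krP_succ, ih (by omega)]
    have : coord N s (mix N t p) = coord N s p.1 := by
      have h : s < t := hs
      simp [coord, mix, h]
    rw [this]

lemma krP_mix (N : ℕ) (μ : Measure (Path N)) [IsFiniteMeasure μ] (t : ℕ) (p : Path N × Path N)
    (s : ℕ) : krP N μ (mix N t p) s = ext N μ t (krP N μ p.1 t, p.2) s := by
  induction s with
  | zero => exact funext fun i => i.elim0
  | succ s ih =>
    by_cases h : s < t
    · rw [krP_mix_le N μ t p (s + 1) h]
      funext i
      rw [ext_apply N μ t _ (s + 1) i i.2 (by omega)]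
      exact (krP_apply N μ p.1 (s + 1) t h i i.2).symm
    · rw [krP_succ, ih]
      have : coord N s (mix N t p) = coord N s p.2 := by
        simp [coord, mix, h]
      simp only [ext, h, dif_neg, not_false_eq_true, this]

lemma proj_krPath (N : ℕ) (μ : Measure (Path N)) [IsFiniteMeasure μ] (u : Path N) (t : ℕ)
    (ht : t ≤ N) : proj N t (krPath N μ u) = krP N μ u t := by
  funext i
  have hi : (i : ℕ) < N := by omega
  simp only [proj, hi, dif_pos]
  exact krP_apply N μ u t N ht i i.2

lemma measurable_krPath (N : ℕ) (μ : Measure (Path N)) [IsFiniteMeasure μ] :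
    Measurable (krPath N μ) := measurable_krP N μ N

lemma map_krP (N : ℕ) (μ : Measure (Path N)) [IsProbabilityMeasure μ] (t : ℕ) (ht : t ≤ N) :
    (uniformCube N).map (fun u => krP N μ u t) = μ.map (proj N t) := by
  induction t with
  | zero =>
    have h1 : (fun u => krP N μ u 0) = fun _ => (Fin.elim0 : Fin 0 → ℝ) :=
      funext fun u => funext fun i => i.elim0
    have h2 : (proj N 0) = fun _ => (Fin.elim0 : Fin 0 → ℝ) :=
      funext fun u => funext fun i => i.elim0
    rw [h1, h2, Measure.map_const, Measure.map_const, measure_univ, measure_univ]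
  | succ t ih =>
    have htN : t < N := ht
    have hk := measurable_krP N μ t
    have : IsProbabilityMeasure (μ.map (proj N t)) :=
      Measure.isProbabilityMeasure_map (measurable_proj N t).aemeasurable
    have hpc : Measurable (fun x => (proj N t x, coord N t x)) :=
      (measurable_proj N t).prodMk (measurable_coord N t)
    -- joint law
    have hj : (uniformCube N).map (fun u => (krP N μ u t, coord N t u))
        = (μ.map (proj N t)).prod unif01 := by
      have hce : (uniformCube N).map (coord N t) = unif01 := by
        have : coord N t = Function.eval (⟨t, htN⟩ : Fin N) := by
          funext x; simp [coord, htN]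
        rw [this]
        exact (measurePreserving_eval (fun _ : Fin N => unif01) ⟨t, htN⟩).map_eq
      conv_lhs => rw [← map_mix N t]
      rw [Measure.map_map (hk.prodMk (measurable_coord N t)) (measurable_mix N t)]
      have : (fun u => (krP N μ u t, coord N t u)) ∘ mix N t
          = Prod.map (fun u => krP N μ u t) (coord N t) := by
        funext p
        simp only [Function.comp, Prod.map, krP_mix_le N μ t p t le_rfl]
        congr 1
        simp [coord, mix]
      rw [this, ← Measure.map_prod_map _ _ hk (measurable_coord N t), ih htN.le, hce]
    have hq := prod_unif_map_qinv (μ.map (proj N t)) (nextK N μ t)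
    have hd : (μ.map (proj N t)) ⊗ₘ (nextK N μ t) = μ.map (fun x => (proj N t x, coord N t x)) := by
      have := (μ.map (fun x => (proj N t x, coord N t x))).disintegrate
        (μ.map (fun x => (proj N t x, coord N t x))).condKernel
      rw [Measure.fst_map_prodMk (measurable_coord N t)] at this
      exact this
    have hqm : Measurable (fun p : (Fin t → ℝ) × ℝ => (p.1, qinv (nextK N μ t p.1) p.2)) :=
      measurable_fst.prodMk (measurable_qinv _)
    rw [hd, ← hj, Measure.map_map hqm (hk.prodMk (measurable_coord N t))] at hq
    have := congrArg (Measure.map (fun p : (Fin t → ℝ) × ℝ => snocFun t p.1 p.2)) hq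
    rw [Measure.map_map (measurable_snocFun t) (hqm.comp (hk.prodMk (measurable_coord N t))),
      Measure.map_map (measurable_snocFun t) hpc] at this
    have hs : (fun p : (Fin t → ℝ) × ℝ => snocFun t p.1 p.2) ∘
        (fun x => (proj N t x, coord N t x)) = proj N (t + 1) := by
      funext x i
      simp only [Function.comp, snocFun, proj, coord]
      by_cases h : (i : ℕ) < t
      · simp [h]
      · have : (i : ℕ) = t := by omega
        simp [this]
    rw [hs] at this
    exact this

lemma map_krPath (N : ℕ) (μ : Measure (Path N)) [IsProbabilityMeasure μ] :
    (uniformCube N).map (krPath N μ) = μ := by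
  have h := map_krP N μ N le_rfl
  have : proj N N = id := by
    funext x i; simp [proj]
  rw [this, Measure.map_id] at h
  exact h

/-- The key conditional independence statement. -/
lemma kr_cond (N : ℕ) (μ ν : Measure (Path N)) [IsProbabilityMeasure μ] [IsProbabilityMeasure ν]
    (t : ℕ) (ht : t ≤ N) {β θ : Type*} [MeasurableSpace β] [StandardBorelSpace β] [Nonempty β]
    [MeasurableSpace θ] (T : Path N → θ) (hT : Measurable T) (S : (Fin t → ℝ) → β)
    (hS : Measurable S) (π : θ → Fin t → ℝ) (hπ : Measurable π) (hTπ : ∀ y, π (T y) = proj N t y) :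
    ∃ κ : Kernel (Fin t → ℝ) β, IsMarkovKernel κ ∧
      (uniformCube N).map (fun u => (T (krPath N μ u), S (proj N t (krPath N ν u))))
        = ((uniformCube N).map (fun u => T (krPath N μ u))) ⊗ₘ (κ.comap π hπ) := by
  have hX := measurable_krP N μ t
  have hY := measurable_krP N ν t
  have hl : Measurable (fun u => (krP N μ u t, S (krP N ν u t))) := hX.prodMk (hS.comp hY)
  let l : Measure ((Fin t → ℝ) × β) := (uniformCube N).map (fun u => (krP N μ u t, S (krP N ν u t)))
  have : IsProbabilityMeasure l := Measure.isProbabilityMeasure_map hl.aemeasurable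
  have hΦ : Measurable (fun p : (Fin t → ℝ) × Path N => T (ext N μ t p N)) :=
    hT.comp (measurable_ext N μ t N)
  have key := compProd_cond l (uniformCube N) (fun p => T (ext N μ t p N)) hΦ π hπ (by
    intro a w
    rw [hTπ]
    funext i
    have hi : (i : ℕ) < N := by omega
    simp only [proj, hi, dif_pos]
    exact ext_apply N μ t (a, w) N i hi i.2)
  have hlp : l.prod (uniformCube N) = ((uniformCube N).prod (uniformCube N)).map
      (Prod.map (fun u => (krP N μ u t, S (krP N ν u t))) id) := by
    rw [← Measure.map_prod_map _ _ hl measurable_id, Measure.map_id]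
  have hm1 : Measurable (fun p : ((Fin t → ℝ) × β) × Path N => T (ext N μ t (p.1.1, p.2) N)) :=
    hΦ.comp ((measurable_fst.comp measurable_fst).prodMk measurable_snd)
  have hm2 : Measurable (fun p : ((Fin t → ℝ) × β) × Path N =>
      (T (ext N μ t (p.1.1, p.2) N), p.1.2)) :=
    hm1.prodMk (measurable_snd.comp measurable_fst)
  refine ⟨l.condKernel, inferInstance, ?_⟩
  rw [hlp, Measure.map_map hm2 (hl.prodMap measurable_id),
    Measure.map_map hm1 (hl.prodMap measurable_id)] at key
  have e1 : (fun u => T (krPath N μ u)) ∘ mix N t =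
      (fun p : ((Fin t → ℝ) × β) × Path N => T (ext N μ t (p.1.1, p.2) N)) ∘
        (Prod.map (fun u => (krP N μ u t, S (krP N ν u t))) id) := by
    funext p
    simp only [Function.comp, Prod.map, id]
    exact congrArg T (krP_mix N μ t p N)
  have e2 : (fun u => (T (krPath N μ u), S (proj N t (krPath N ν u)))) ∘ mix N t =
      (fun p : ((Fin t → ℝ) × β) × Path N => (T (ext N μ t (p.1.1, p.2) N), p.1.2)) ∘
        (Prod.map (fun u => (krP N μ u t, S (krP N ν u t))) id) := by
    funext p
    simp only [Function.comp, Prod.map, id]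
    refine Prod.ext (congrArg T (krP_mix N μ t p N)) ?_
    simp only [proj_krPath N ν _ t ht, krP_mix_le N ν t p t le_rfl]
  rw [← e1, ← e2] at key
  have hTm : Measurable (fun u => T (krPath N μ u)) := hT.comp (measurable_krPath N μ)
  have hTm2 : Measurable (fun u => (T (krPath N μ u), S (proj N t (krPath N ν u)))) :=
    hTm.prodMk (hS.comp ((measurable_proj N t).comp (measurable_krPath N ν)))
  rw [← Measure.map_map hTm2 (measurable_mix N t), ← Measure.map_map hTm (measurable_mix N t),
    map_mix] at key
  exact key

lemma kr_causal (N : ℕ) (μ ν : Measure (Path N)) [IsProbabilityMeasure μ]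
    [IsProbabilityMeasure ν] : IsCausal N μ ν (krCoupling N μ ν) := by
  have hX := measurable_krPath N μ
  have hY := measurable_krPath N ν
  refine ⟨⟨?_, ?_⟩, ?_⟩
  · rw [krCoupling, Measure.map_map measurable_fst (hX.prodMk hY)]
    exact map_krPath N μ
  · rw [krCoupling, Measure.map_map measurable_snd (hX.prodMk hY)]
    exact map_krPath N ν
  · intro K hK hKγ t _ htN B hB
    obtain ⟨B', hB', rfl⟩ := hB
    have hp := measurable_proj N t
    obtain ⟨κ, hκ, h⟩ := kr_cond N μ ν t htN id measurable_id (id : (Fin t → ℝ) → _) measurable_id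
      (proj N t) hp (fun _ => rfl)
    refine ⟨fun x => κ (proj N t x) B', ?_, ?_⟩
    · exact (κ.measurable_coe hB').comp (comap_measurable (proj N t))
    · refine ae_eq_of_forall_setLIntegral_eq_of_sigmaFinite (K.measurable_coe (hp hB'))
        ((κ.measurable_coe hB').comp hp) fun A hA _ => ?_
      rw [← Measure.compProd_apply_prod hA (hp hB'), hKγ]
      have h2 : ∫⁻ x in A, κ (proj N t x) B' ∂μ = (μ ⊗ₘ (κ.comap (proj N t) hp)) (A ×ˢ B') := by
        rw [Measure.compProd_apply_prod hA hB']; rfl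
      rw [h2]
      simp only [id] at h
      rw [map_krPath N μ] at h
      rw [← h, krCoupling, Measure.map_apply (hX.prodMk hY) (hA.prod (hp hB')),
        Measure.map_apply (f := fun u => (krPath N μ u, proj N t (krPath N ν u)))
          (hX.prodMk (hp.comp hY)) (hA.prod hB')]
      rfl

theorem knothe_rosenblatt_is_bicausal
    (N : ℕ) (μ ν : Measure (Path N)) [IsProbabilityMeasure μ] [IsProbabilityMeasure ν] :
    IsBicausal N μ ν (krCoupling N μ ν)
    ∧ (∀ hN : 2 ≤ N,
        ∃ κ : Kernel ℝ ℝ,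
          ∀ᵐ q ∂(((uniformCube N).map
              (fun u => ((krPath N ν u ⟨0, by omega⟩, krPath N ν u ⟨1, by omega⟩),
                krPath N μ u ⟨0, by omega⟩))).fst),
            ((uniformCube N).map
              (fun u => ((krPath N ν u ⟨0, by omega⟩, krPath N ν u ⟨1, by omega⟩),
                krPath N μ u ⟨0, by omega⟩))).condKernel q = κ q.1) := by
  refine ⟨⟨kr_causal N μ ν, ?_⟩, ?_⟩
  · have : (krCoupling N μ ν).map Prod.swap = krCoupling N ν μ := by
      rw [krCoupling, Measure.map_map measurable_swap
        ((measurable_krPath N μ).prodMk (measurable_krPath N ν))]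
      rfl
    rw [this]
    exact kr_causal N ν μ
  · intro hN
    have hπ : Measurable (fun q : ℝ × ℝ => (fun _ => q.1 : Fin 1 → ℝ)) :=
      measurable_pi_lambda _ fun _ => measurable_fst
    have hT : Measurable (fun y : Path N => (y ⟨0, by omega⟩, y ⟨1, by omega⟩)) :=
      (measurable_pi_apply _).prodMk (measurable_pi_apply _)
    obtain ⟨κ, hκ, h⟩ := kr_cond N ν μ 1 (by omega)
      (fun y : Path N => (y ⟨0, by omega⟩, y ⟨1, by omega⟩)) hT
      (fun x : Fin 1 → ℝ => x 0) (measurable_pi_apply _) (fun q _ => q.1) hπ (by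
        intro y
        funext i
        have hi : i = 0 := Subsingleton.elim _ _
        subst hi
        have : 0 < N := by omega
        simp [proj, this])
    have hc : Measurable (fun r : ℝ => (fun _ => r : Fin 1 → ℝ)) :=
      measurable_pi_lambda _ fun _ => measurable_id
    have hS : ∀ x : Path N, proj N 1 x 0 = x ⟨0, by omega⟩ := by
      intro x
      have : 0 < N := by omega
      simp [proj, this]
    simp only [hS] at h
    refine ⟨κ.comap _ hc, ?_⟩
    have hm1 : Measurable (fun u : Path N =>
        (krPath N ν u ⟨0, by omega⟩, krPath N ν u ⟨1, by omega⟩)) :=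
      hT.comp (measurable_krPath N ν)
    have hm2 : Measurable (fun u : Path N => krPath N μ u ⟨0, by omega⟩) :=
      (measurable_pi_apply _).comp (measurable_krPath N μ)
    rw [← Measure.fst_map_prodMk (μ := uniformCube N) (X := fun u : Path N =>
        (krPath N ν u ⟨0, by omega⟩, krPath N ν u ⟨1, by omega⟩)) hm2] at h
    haveI : IsProbabilityMeasure ((uniformCube N).map
              (fun u => ((krPath N ν u ⟨0, by omega⟩, krPath N ν u ⟨1, by omega⟩),
                krPath N μ u ⟨0, by omega⟩))) :=
      Measure.isProbabilityMeasure_map (hm1.prodMk hm2).aemeasurable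
    have := eq_condKernel_of_measure_eq_compProd _ h
    filter_upwards [this] with q hq
    rw [← hq]
    rfl

end CausalTransport
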